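/- arXiv:2604.28006 — 2 statements merged into one kernel-verified Lean document; each statement's English description precedes it below -/
import Mathlib

section
/- (LDS + classical open-loop, conditional form) Let M ⊆ C be nonempty and let (x_t) be the Frank–Wolfe iterates generated by the classical open-loop rule γ_t = 2/(t+2). Suppose C together with its LMO satisfies local dual sharpness around M with some constants (A, q), q ≥ 2. Let x* ∈ argmin_{x∈C} f(x), and let (p_t) ⊆ M satisfy f(p_t) = f(x*) for all t. If δ_t := ‖x_t − p_t‖ → 0, then (t+2)(f(x_t) − f(x*)) → 0. -/
open scoped RealInnerProductSpace
open Filter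

/-- First-order lower bound for a convex function with a gradient. -/
theorem ConvexOn.add_inner_gradient_le {E : Type*} [NormedAddCommGroup E] [InnerProductSpace ℝ E]
    [CompleteSpace E] {f : E → ℝ} {g x : E} (hf : ConvexOn ℝ Set.univ f)
    (hg : HasGradientAt f g x) (y : E) : f x + ⟪g, y - x⟫ ≤ f y := by
  have hconv : ConvexOn ℝ Set.univ (f ∘ AffineMap.lineMap (k := ℝ) x y) := by
    simpa using hf.comp_affineMap (AffineMap.lineMap (k := ℝ) x y)
  have hderiv : HasDerivAt (f ∘ AffineMap.lineMap (k := ℝ) x y) ⟪g, y - x⟫ 0 := by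
    have hline : HasDerivAt (AffineMap.lineMap (k := ℝ) x y) (y - x) (0 : ℝ) :=
      AffineMap.hasDerivAt_lineMap
    have hg' : HasFDerivAt f (InnerProductSpace.toDual ℝ E g)
        (AffineMap.lineMap (k := ℝ) x y (0 : ℝ)) := by
      simpa using hg.hasFDerivAt
    simpa using hg'.comp_hasDerivAt (0 : ℝ) hline
  have := hconv.le_slope_of_hasDerivAt (Set.mem_univ (0 : ℝ)) (Set.mem_univ (1 : ℝ)) one_pos hderiv
  simp [slope_def_field] at this
  linarith

/-- If `h` is eventually small compared with the open-loop step size, or else decreases by at least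
the factor `t / (t + 2)` up to a small multiple of the squared step size, then `h = o(1 / t)`. -/
theorem tendsto_open_loop_of_forall_eventually {h : ℕ → ℝ} (hnn : ∀ t, 0 ≤ h t) {B : ℝ} (hB : 0 ≤ B)
    (hstep : ∀ η > 0, ∀ᶠ t : ℕ in atTop,
      ((t : ℝ) + 1) * (t + 2) * h (t + 1) ≤ t * (t + 1) * h t + η ∨
      ((t : ℝ) + 1) * (t + 2) * h (t + 1) ≤ η * t + B) :
    Tendsto (fun t : ℕ => ((t : ℝ) + 2) * h t) atTop (nhds 0) := by
  rw [Metric.tendsto_atTop]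
  intro r hr
  obtain ⟨T, hT⟩ := eventually_atTop.1 (hstep (r / 4) (by positivity))
  set K : ℝ := (T : ℝ) * (T + 1) * h T + B with hK
  have hET : 0 ≤ (T : ℝ) * (T + 1) * h T := mul_nonneg (by positivity) (hnn T)
  have hbound : ∀ t ≥ T, (t : ℝ) * (t + 1) * h t ≤ r / 4 * t + K := by
    intro t ht
    induction t, ht using Nat.le_induction with
    | base =>
      have : 0 ≤ r / 4 * (T : ℝ) := by positivity
      linarith
    | succ t ht ih =>
      push_cast
      have : ((t : ℝ) + 1) * (t + 1 + 1) * h (t + 1) = (t + 1) * (t + 2) * h (t + 1) := by ring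
      rcases hT t ht with h1 | h1 <;> linarith
  obtain ⟨N, hN⟩ := exists_nat_gt (4 * K / r)
  refine ⟨max (max T N) 1, fun t ht => ?_⟩
  have ht1 : (1 : ℝ) ≤ t := by exact_mod_cast (le_max_right _ _).trans ht
  have htT : T ≤ t := ((le_max_left _ _).trans (le_max_left _ _)).trans ht
  have htN : (N : ℝ) ≤ t := by exact_mod_cast ((le_max_right _ _).trans (le_max_left _ _)).trans ht
  have hKt : 4 * K < r * t := by
    have := (div_lt_iff₀ hr).1 (hN.trans_le htN)
    linarith
  have hnn' : 0 ≤ ((t : ℝ) + 2) * h t := mul_nonneg (by positivity) (hnn t)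
  rw [Real.dist_eq, sub_zero, abs_of_nonneg hnn']
  have hsmall : (t : ℝ) * ((t + 1) * h t) < t * (r / 2) := by
    have := hbound t htT
    linarith
  have hsmall' := lt_of_mul_lt_mul_left hsmall (by positivity)
  have := mul_le_mul_of_nonneg_right ht1 (hnn t)
  linarith [hnn t]

/-- **LDS + classical open-loop, conditional form.**
Under local dual sharpness around a nonempty set `M ⊆ C`, if the open-loop
Frank–Wolfe iterates (`γ_t = 2/(t+2)`) admit points `p_t ∈ M` with
`f(p_t) = f(x*)` for a minimizer `x*` and `‖x_t - p_t‖ → 0`, then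
`(t+2)(f(x_t) - f(x*)) → 0`. -/
theorem lds_open_loop_conditional
    {d : ℕ} {C : Set (EuclideanSpace ℝ (Fin d))}
    (hCne : C.Nonempty) (hCcomp : IsCompact C) (hCconv : Convex ℝ C)
    {f : EuclideanSpace ℝ (Fin d) → ℝ}
    {f' : EuclideanSpace ℝ (Fin d) → EuclideanSpace ℝ (Fin d)}
    (hfconv : ConvexOn ℝ Set.univ f)
    (hgrad : ∀ y, HasGradientAt f (f' y) y)
    {L : ℝ} (hL : 0 < L)
    (hsmooth : ∀ x ∈ C, ∀ y ∈ C,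
      f y ≤ f x + ⟪f' x, y - x⟫ + L / 2 * ‖y - x‖ ^ 2)
    {M : Set (EuclideanSpace ℝ (Fin d))} (hMne : M.Nonempty) (hMC : M ⊆ C)
    {lmo : EuclideanSpace ℝ (Fin d) → EuclideanSpace ℝ (Fin d)}
    (hlmo : ∀ g, lmo g ∈ C ∧ ∀ y ∈ C, ⟪g, lmo g⟫ ≤ ⟪g, y⟫)
    {A q : ℝ} (hA : 0 < A) (hq : 2 ≤ q)
    (hLDS : ∃ ρ > (0 : ℝ), ∀ x ∈ C, Metric.infDist x M < ρ →
      ∀ g : EuclideanSpace ℝ (Fin d),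
        A * ‖g‖ * ‖x - lmo g‖ ^ q ≤ ⟪g, x - lmo g⟫)
    {x s : ℕ → EuclideanSpace ℝ (Fin d)} {γ : ℕ → ℝ}
    (hx0 : x 0 ∈ C)
    (hs : ∀ t, s t = lmo (f' (x t)))
    (hupd : ∀ t, x (t + 1) = x t + γ t • (s t - x t))
    (hγ : ∀ t, γ t = 2 / ((t : ℝ) + 2))
    {xstar : EuclideanSpace ℝ (Fin d)}
    (hxstar : xstar ∈ C) (hxstarmin : ∀ y ∈ C, f xstar ≤ f y)
    {p : ℕ → EuclideanSpace ℝ (Fin d)}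
    (hpM : ∀ t, p t ∈ M)
    (hpf : ∀ t, f (p t) = f xstar)
    (hδ : Tendsto (fun t => ‖x t - p t‖) atTop (nhds 0)) :
    Tendsto (fun t : ℕ => ((t : ℝ) + 2) * (f (x t) - f xstar)) atTop (nhds 0) := by
  obtain ⟨ρ, hρ, hLDS⟩ := hLDS
  have hγnn : ∀ t, 0 < γ t := fun t => by rw [hγ]; positivity
  have hγle : ∀ t, γ t ≤ 1 := fun t => by
    rw [hγ, div_le_one (by positivity)]
    linarith [Nat.cast_nonneg (α := ℝ) t]
  have hsC : ∀ t, s t ∈ C := fun t => hs t ▸ (hlmo _).1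
  have hxC : ∀ t, x t ∈ C := by
    intro t
    induction t with
    | zero => exact hx0
    | succ t ih => exact hupd t ▸ hCconv.add_smul_sub_mem ih (hsC t) ⟨(hγnn t).le, hγle t⟩
  set h : ℕ → ℝ := fun t => f (x t) - f xstar with hh
  have hnn : ∀ t, 0 ≤ h t := fun t => sub_nonneg.2 (hxstarmin _ (hxC t))
  obtain ⟨D, hD⟩ := Metric.isBounded_iff.1 hCcomp.isBounded
  have hdD : ∀ t, ‖x t - s t‖ ≤ D := fun t => dist_eq_norm (x t) (s t) ▸ hD (hxC t) (hsC t)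
  have hD0 : 0 ≤ D := (norm_nonneg _).trans (hdD 0)
  set G : ℕ → ℝ := fun t => ⟪f' (x t), x t - s t⟫ with hG
  have hfirst : ∀ t, h t ≤ ⟪f' (x t), x t - p t⟫ := by
    intro t
    have := hfconv.add_inner_gradient_le (hgrad (x t)) (p t)
    rw [hpf, inner_sub_right] at this
    rw [inner_sub_right]
    simp only [hh]
    linarith
  have hhG : ∀ t, h t ≤ G t := by
    intro t
    refine (hfirst t).trans ?_
    simp only [hG, inner_sub_right, hs]
    linarith [(hlmo (f' (x t))).2 _ (hMC (hpM t))]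
  have hdescent : ∀ t, h (t + 1) ≤ h t - γ t * G t + L / 2 * (γ t) ^ 2 * ‖x t - s t‖ ^ 2 := by
    intro t
    have := hsmooth _ (hxC t) _ (hxC (t + 1))
    have hdiff : x (t + 1) - x t = -(γ t • (x t - s t)) := by
      rw [hupd, ← smul_neg, neg_sub]; abel
    rw [hdiff, inner_neg_right, inner_smul_right, norm_neg, norm_smul, Real.norm_eq_abs, mul_pow,
      sq_abs] at this
    simp only [hh, hG]
    linarith
  have hscale : ∀ t (R : ℝ), h (t + 1) ≤ (1 - γ t) * h t + L / 2 * (γ t) ^ 2 * R → 0 ≤ R →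
      ((t : ℝ) + 1) * (t + 2) * h (t + 1) ≤ t * (t + 1) * h t + 2 * L * R := by
    intro t R hle hR
    have hpos : (0 : ℝ) < (t + 1) * (t + 2) := by positivity
    refine (mul_le_mul_of_nonneg_left hle hpos.le).trans ?_
    have h1 : ((t : ℝ) + 1) * (t + 2) * ((1 - γ t) * h t + L / 2 * (γ t) ^ 2 * R)
        = t * (t + 1) * h t + 2 * L * R * ((t + 1) / (t + 2)) := by
      rw [hγ]; field_simp; ring
    have h2 : ((t : ℝ) + 1) / (t + 2) ≤ 1 := by
      rw [div_le_one (by positivity)]; linarith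
    rw [h1]
    linarith [mul_le_mul_of_nonneg_left h2 (show 0 ≤ 2 * L * R by positivity)]
  refine tendsto_open_loop_of_forall_eventually hnn (B := 2 * L * D ^ 2) (by positivity) ?_
  intro η hη
  set ε : ℝ := Real.sqrt (η / (2 * L)) with hε
  have hεpos : 0 < ε := Real.sqrt_pos.2 (by positivity)
  have hεsq : 2 * L * ε ^ 2 = η := by
    rw [hε, Real.sq_sqrt (by positivity)]; field_simp
  set K : ℝ := 1 + L * D ^ 2 / η with hK
  have hKpos : 0 < K := by positivity
  have hεq : 0 < A * ε ^ q / K := by positivity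
  filter_upwards [hδ.eventually_lt_const hρ, hδ.eventually_lt_const hεq] with t htρ htK
  have hγG := mul_le_mul_of_nonneg_left (hhG t) (hγnn t).le
  have hγsq : 0 ≤ L / 2 * (γ t) ^ 2 := by positivity
  rcases le_total (‖x t - s t‖) ε with hdε | hdε
  · left
    rw [← hεsq]
    refine hscale t _ ?_ (by positivity)
    have := mul_le_mul_of_nonneg_left (pow_le_pow_left₀ (norm_nonneg _) hdε 2) hγsq
    linarith [hdescent t]
  have hdsq := mul_le_mul_of_nonneg_left (pow_le_pow_left₀ (norm_nonneg _) (hdD t) 2) hγsq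
  rcases le_total (h t) (γ t * (η / 2)) with hsmall | hlarge
  · right
    refine (hscale t (D ^ 2) (by linarith [hdescent t]) (by positivity)).trans ?_
    have h1 : (t : ℝ) * (t + 1) * h t ≤ t * (t + 1) * (γ t * (η / 2)) := by gcongr
    have h2 : (t : ℝ) * (t + 1) * (γ t * (η / 2)) = η * t * ((t + 1) / (t + 2)) := by
      rw [hγ]; field_simp
    have h3 : ((t : ℝ) + 1) / (t + 2) ≤ 1 := by
      rw [div_le_one (by positivity)]; linarith
    linarith [mul_le_mul_of_nonneg_left h3 (show 0 ≤ η * (t : ℝ) by positivity)]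
  · left
    have hsharp : K * h t ≤ G t := by
      have hdist : Metric.infDist (x t) M < ρ :=
        (Metric.infDist_le_dist_of_mem (hpM t)).trans_lt (dist_eq_norm (x t) (p t) ▸ htρ)
      have hlds := hLDS _ (hxC t) hdist (f' (x t))
      rw [← hs] at hlds
      have hKδ : ‖x t - p t‖ * K ≤ A * ε ^ q := ((lt_div_iff₀ hKpos).1 htK).le
      calc K * h t ≤ K * (‖f' (x t)‖ * ‖x t - p t‖) := by
            gcongr; exact (hfirst t).trans (real_inner_le_norm _ _)
        _ = ‖f' (x t)‖ * (‖x t - p t‖ * K) := by ring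
        _ ≤ ‖f' (x t)‖ * (A * ε ^ q) := by gcongr
        _ = A * ‖f' (x t)‖ * ε ^ q := by ring
        _ ≤ A * ‖f' (x t)‖ * ‖x t - s t‖ ^ q := by gcongr
        _ ≤ G t := hlds
    have hγK := mul_le_mul_of_nonneg_left hsharp (hγnn t).le
    have hcancel : L / 2 * (γ t) ^ 2 * D ^ 2 ≤ γ t * (L * D ^ 2 / η * h t) := by
      have hc : 0 ≤ γ t * (L * D ^ 2 / η) := mul_nonneg (hγnn t).le (by positivity)
      have h1 := mul_le_mul_of_nonneg_left hlarge hc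
      have h2 : γ t * (L * D ^ 2 / η) * (γ t * (η / 2)) = L / 2 * (γ t) ^ 2 * D ^ 2 := by
        field_simp
      linarith
    have hexp : γ t * (K * h t) = γ t * h t + γ t * (L * D ^ 2 / η * h t) := by
      rw [hK]; ring
    have := hscale t 0 (by linarith [hdescent t]) le_rfl
    linarith
end

section
/- (Quantitative rate under LDS plus a local Hölder error bound) Suppose C together with its LMO satisfies local dual sharpness around the minimizer set 𝓜 = argmin_{x∈C} f(x) with constants (A, q), q ≥ 2, and that f satisfies a local Hölder error bound of order r ≥ 2 around 𝓜 with constants (B, ρ). Then for the Frank–Wolfe algorithm with the short-step rule, with exact line search, or with the classical open-loop rule γ_t = 2/(t+2), there exist t_0 ∈ ℕ and K > 0 such that f(x_t) − f* ≤ K/(t − t_0 + 1)^{rq/(rq−2)} for all t ≥ t_0. -/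
open scoped RealInnerProductSpace
open Filter

/-- A sequence that at each step either drops below a multiple of `(2 / (t + 2)) ^ p` or contracts
by the factor `1 - p / (t + 2) + O((t + 2)⁻²)` decays like `t ^ (-p)`. -/
lemma exists_le_div_rpow_of_step {h : ℕ → ℝ} (h_nonneg : ∀ t, 0 ≤ h t) {p c E : ℝ} (hp : 1 ≤ p)
    (hc : 0 ≤ c) (hE : 0 ≤ E) {T : ℕ}
    (hstep : ∀ t ≥ T, h (t + 1) ≤ E * (2 / ((t : ℝ) + 2)) ^ p ∨
      h (t + 1) ≤ (1 - p / ((t : ℝ) + 2) + c / ((t : ℝ) + 2) ^ 2) * h t) :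
    ∃ t0 : ℕ, ∃ K > (0 : ℝ), ∀ t : ℕ, t0 ≤ t → h t ≤ K / ((t - t0 + 1 : ℕ) : ℝ) ^ p := by
  obtain ⟨m, hm⟩ := exists_nat_ge (2 * c)
  have hm0 : (0 : ℝ) ≤ m := m.cast_nonneg
  set t0 := max T m with ht0
  set K := 1 + h t0 * ((t0 : ℝ) + 2 + m) ^ p + E * 4 ^ p with hK
  have hK0 : 0 < K := by have := h_nonneg t0; positivity
  have key : ∀ t, t0 ≤ t → h t ≤ K / ((t : ℝ) + 2 + m) ^ p := by
    intro t ht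
    induction t, ht using Nat.le_induction with
    | base =>
      rw [le_div_iff₀ (by positivity)]
      have : 0 ≤ E * 4 ^ p := by positivity
      linarith
    | succ t ht ih =>
      have hmt : (m : ℝ) ≤ t := by exact_mod_cast (le_max_right T m).trans ht
      set n : ℝ := (t : ℝ) + 2 with hn
      have hn0 : 0 < n := by positivity
      have hcast : ((t + 1 : ℕ) : ℝ) + 2 + m = n + m + 1 := by push_cast; ring
      rw [hcast]
      have hw : 0 < n + m + 1 := by positivity
      rcases hstep t ((le_max_left T m).trans ht) with h1 | h1
      · refine h1.trans ?_
        have : 2 / n ≤ 4 / (n + m + 1) := by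
          rw [div_le_div_iff₀ hn0 hw]; linarith
        calc E * (2 / n) ^ p ≤ E * (4 / (n + m + 1)) ^ p := by gcongr
          _ = E * 4 ^ p / (n + m + 1) ^ p := by
            rw [Real.div_rpow (by norm_num) hw.le]; ring
          _ ≤ K / (n + m + 1) ^ p := by
            gcongr
            have : 0 ≤ h t0 * ((t0 : ℝ) + 2 + m) ^ p := by
              have := h_nonneg t0; positivity
            linarith
      · have hcoef : 1 - p / n + c / n ^ 2 ≤ 1 - p / (n + m + 1) := by
          have h2 : c / n ^ 2 ≤ p / n - p / (n + m + 1) := by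
            have e : p / n - p / (n + m + 1) = p * (m + 1) / (n * (n + m + 1)) := by
              field_simp; ring
            rw [e, div_le_div_iff₀ (by positivity) (by positivity)]
            have a1 : c * (n + m + 1) ≤ p * (m + 1) * n := by
              calc c * (n + m + 1) ≤ c * (2 * n) := by gcongr; linarith
                _ = 1 * (2 * c) * n := by ring
                _ ≤ p * (m + 1) * n := by gcongr; linarith
            calc c * (n * (n + m + 1)) = c * (n + m + 1) * n := by ring
              _ ≤ p * (m + 1) * n * n := by gcongr
              _ = _ := by ring
          linarith
        have hbern : 1 - p / (n + m + 1) ≤ ((n + m) / (n + m + 1)) ^ p := by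
          have := one_add_mul_self_le_rpow_one_add (s := -(1 / (n + m + 1))) (p := p) (by
            rw [neg_le_neg_iff, div_le_one hw]; linarith) hp
          calc _ = 1 + p * -(1 / (n + m + 1)) := by ring
            _ ≤ _ := this
            _ = _ := by congr 1; field_simp; ring
        calc h (t + 1) ≤ (1 - p / n + c / n ^ 2) * h t := h1
          _ ≤ ((n + m) / (n + m + 1)) ^ p * h t :=
            mul_le_mul_of_nonneg_right (hcoef.trans hbern) (h_nonneg t)
          _ ≤ ((n + m) / (n + m + 1)) ^ p * (K / (n + m) ^ p) := by gcongr
          _ = K / (n + m + 1) ^ p := by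
            rw [Real.div_rpow (by positivity) hw.le]
            have : (n + m) ^ p ≠ 0 := by positivity
            field_simp
  refine ⟨t0, K, hK0, fun t ht => (key t ht).trans ?_⟩
  have h1 : ((t - t0 + 1 : ℕ) : ℝ) ≤ (t : ℝ) + 2 + m := by
    have : t - t0 + 1 ≤ t + 2 + m := by omega
    exact_mod_cast this
  have h2 : (0 : ℝ) < ((t - t0 + 1 : ℕ) : ℝ) := by positivity
  gcongr

/-- The classical `O(1/t)` recursion for Frank–Wolfe with step sizes `2 / (t + 2)`. -/
lemma tendsto_zero_of_openLoop_step {h : ℕ → ℝ} (h_nonneg : ∀ t, 0 ≤ h t) {R : ℝ}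
    (hstep : ∀ t : ℕ, h (t + 1) ≤
      (1 - 2 / ((t : ℝ) + 2)) * h t + (2 / ((t : ℝ) + 2)) ^ 2 * R) :
    Tendsto h atTop (nhds 0) := by
  have hR : 0 ≤ R := by
    have h0 := hstep 0
    have h1 := h_nonneg 1
    norm_num at h0
    linarith
  have key : ∀ t : ℕ, h (t + 1) ≤ 4 * R / ((t : ℝ) + 3) := by
    intro t
    induction t with
    | zero =>
      have h0 := hstep 0
      norm_num at h0 ⊢
      linarith
    | succ t ih =>
      refine (hstep (t + 1)).trans ?_
      push_cast
      have ht : (0 : ℝ) ≤ t := t.cast_nonneg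
      have e : (t : ℝ) + 1 + 2 = t + 3 := by ring
      have e' : (t : ℝ) + 1 + 3 = t + 4 := by ring
      rw [e, e']
      have hc : 0 ≤ 1 - 2 / ((t : ℝ) + 3) := by
        rw [sub_nonneg, div_le_one (by positivity)]; linarith
      calc (1 - 2 / ((t : ℝ) + 3)) * h (t + 1) + (2 / ((t : ℝ) + 3)) ^ 2 * R
          ≤ (1 - 2 / ((t : ℝ) + 3)) * (4 * R / (t + 3)) + (2 / ((t : ℝ) + 3)) ^ 2 * R := by gcongr
        _ = 4 * R * ((t + 2) / (t + 3) ^ 2) := by field_simp; ring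
        _ ≤ 4 * R * (1 / (t + 4)) := by
          gcongr 4 * R * ?_
          rw [div_le_div_iff₀ (by positivity) (by positivity)]
          nlinarith
        _ = _ := by ring
  rw [← tendsto_add_atTop_iff_nat 1]
  refine squeeze_zero (fun t => h_nonneg _) key ?_
  exact tendsto_const_nhds.div_atTop
    (tendsto_atTop_add_const_right _ _ tendsto_natCast_atTop_atTop)

/-- The distance to the Frank–Wolfe atom is controlled by the ratio of the Frank–Wolfe gap `g` and
the primal gap `h`. -/
lemma sq_le_of_sharpness_of_errorBound {A B q r h g G D : ℝ} (hA : 0 < A) (hB : 0 < B)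
    (hq : 2 ≤ q) (hh : 0 < h) (hhg : h ≤ g) (hD : 0 ≤ D)
    (hsharp : A * G * D ^ q ≤ g) (hgrad : h ≤ G * (B * h) ^ (1 / r)) :
    D ^ 2 ≤ (B ^ (1 / r) / A) ^ (2 / q) * (g / h) * h ^ (2 / (r * q)) := by
  have hq0 : 0 < q := by linarith
  set w := (B * h) ^ (1 / r) with hw
  have hw0 : 0 < w := by positivity
  have h1 : D ^ q ≤ g / h * (w / A) := by
    rw [div_mul_div_comm, le_div_iff₀ (by positivity)]
    calc D ^ q * (h * A) ≤ D ^ q * (G * w * A) := by gcongr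
      _ = A * G * D ^ q * w := by ring
      _ ≤ g * w := by gcongr
  have hg0 : 0 < g := hh.trans_le hhg
  calc D ^ 2 = (D ^ q) ^ (2 / q) := by
        rw [← Real.rpow_mul hD, mul_div_cancel₀ _ hq0.ne', Real.rpow_two]
    _ ≤ (g / h * (w / A)) ^ (2 / q) := by gcongr
    _ = (g / h) ^ (2 / q) * (w / A) ^ (2 / q) := by
        rw [Real.mul_rpow (by positivity) (by positivity)]
    _ ≤ (g / h) * (w / A) ^ (2 / q) := by
        gcongr
        exact Real.rpow_le_self_of_one_le ((one_le_div hh).2 hhg) ((div_le_one hq0).2 hq)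
    _ = _ := by
        have e : h ^ (2 / (r * q)) = (h ^ (1 / r)) ^ (2 / q) := by
          rw [← Real.rpow_mul hh.le]; congr 1; rw [div_mul_div_comm, one_mul]
        rw [e, hw, Real.mul_rpow hB.le hh.le, mul_div_right_comm,
          Real.mul_rpow (by positivity) (by positivity)]
        ring

section Gradient

variable {F : Type*} [NormedAddCommGroup F] [InnerProductSpace ℝ F] [CompleteSpace F]
  {f : F → ℝ} {f' : F → F}

lemma ConvexOn.add_inner_gradient_le_s12 {v x : F} (hf : ConvexOn ℝ Set.univ f)
    (hv : HasGradientAt f v x) (z : F) : f x + ⟪v, z - x⟫ ≤ f z := by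
  have hline : HasDerivAt (fun τ : ℝ => x + τ • (z - x)) (z - x) 0 := by
    simpa using ((hasDerivAt_id (0 : ℝ)).smul_const (z - x)).const_add x
  have hder : HasDerivAt (fun τ : ℝ => f (x + τ • (z - x))) ⟪v, z - x⟫ 0 := by
    have hv' : HasGradientAt f v (x + (0 : ℝ) • (z - x)) := by simpa using hv
    have := hv'.hasFDerivAt.comp_hasDerivAt (0 : ℝ) hline
    simpa [Function.comp_def] using this
  have hconv : ConvexOn ℝ Set.univ (fun τ : ℝ => f (x + τ • (z - x))) := by
    have := hf.comp_affineMap (AffineMap.lineMap x z)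
    simpa [Function.comp_def, AffineMap.lineMap_apply, add_comm] using this
  have := hconv.le_slope_of_hasDerivAt (Set.mem_univ 0) (Set.mem_univ 1) one_pos hder
  simp [slope_def_field] at this
  linarith

/-- The Frank–Wolfe gap exceeds the primal gap by a constant factor at points satisfying a
quadratic growth bound relative to a minimizer `y` with vanishing gradient. -/
lemma exists_slack_mul_le_inner_gradient {C : Set F} (hCconv : Convex ℝ C)
    (hfconv : ConvexOn ℝ Set.univ f) (hgrad : ∀ y, HasGradientAt f (f' y) y) {L B : ℝ}
    (hL : 0 < L) (hB : 0 < B)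
    (hsmooth : ∀ x ∈ C, ∀ y ∈ C, f y ≤ f x + ⟪f' x, y - x⟫ + L / 2 * ‖y - x‖ ^ 2) :
    ∃ δ > (0 : ℝ), ∀ x ∈ C, ∀ y ∈ C, f' y = 0 → f y ≤ f x → ‖x - y‖ ^ 2 ≤ B * (f x - f y) →
      (1 + δ) * (f x - f y) ≤ ⟪f' x, x - y⟫ := by
  set τ : ℝ := min (1 / (L * B)) (1 / 2) with hτ
  have hτ0 : 0 < τ := by positivity
  have hτ1 : τ ≤ 1 / 2 := min_le_right _ _
  have hτ2 : L * B * τ ≤ 1 := by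
    have : τ ≤ 1 / (L * B) := min_le_left _ _
    rw [le_div_iff₀ (by positivity)] at this
    linarith
  refine ⟨τ / 2, by positivity, fun x hx y hy hy0 hyx hdist => ?_⟩
  have hz : y + τ • (x - y) ∈ C := hCconv.add_smul_sub_mem hy hx ⟨hτ0.le, by linarith⟩
  have h1 := hsmooth y hy _ hz
  have h2 := hfconv.add_inner_gradient_le_s12 (hgrad x) (y + τ • (x - y))
  have e1 : y + τ • (x - y) - x = -((1 - τ) • (x - y)) := by module
  rw [hy0, inner_zero_left, add_sub_cancel_left, norm_smul, Real.norm_of_nonneg hτ0.le,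
    mul_pow] at h1
  rw [e1, inner_neg_right, inner_smul_right] at h2
  set P := ⟪f' x, x - y⟫
  set H := f x - f y with hH
  have hH0 : 0 ≤ H := sub_nonneg.2 hyx
  have h3 : L / 2 * (τ ^ 2 * ‖x - y‖ ^ 2) ≤ τ / 2 * H := by
    calc L / 2 * (τ ^ 2 * ‖x - y‖ ^ 2) ≤ L / 2 * (τ ^ 2 * (B * H)) := by gcongr
      _ = (L * B * τ) * (τ / 2 * H) := by ring
      _ ≤ 1 * (τ / 2 * H) := by gcongr
      _ = _ := one_mul _
  have h4 : (1 - τ / 2) * H ≤ (1 - τ) * P := by linarith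
  have h5 : (1 - τ) * ((1 + τ / 2) * H) ≤ (1 - τ) * P := by nlinarith
  exact le_of_mul_le_mul_left h5 (by linarith)

end Gradient

/-- The short step minimizes the quadratic model `τ ↦ -τ g + τ² a / 2` over `τ ≤ 1`. -/
lemma shortStep_model_le {a g τ : ℝ} (ha : 0 < a) (hτ : τ ≤ 1) :
    -(min (g / a) 1 * g) + min (g / a) 1 ^ 2 * (a / 2) ≤ -(τ * g) + τ ^ 2 * (a / 2) := by
  rcases le_total (g / a) 1 with h | h
  · rw [min_eq_left h]
    obtain ⟨w, rfl⟩ : ∃ w, g = w * a := ⟨g / a, (div_mul_cancel₀ _ ha.ne').symm⟩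
    rw [mul_div_cancel_right₀ _ ha.ne']
    nlinarith [mul_nonneg ha.le (sq_nonneg (τ - w))]
  · rw [min_eq_right h]
    rw [le_div_iff₀ ha, one_mul] at h
    nlinarith [mul_nonneg (sub_nonneg.2 hτ) (sub_nonneg.2 h),
      mul_nonneg ha.le (sq_nonneg (1 - τ))]

/-- One Frank–Wolfe step either leaves the primal gap of order `γ ^ p` or contracts it. -/
lemma step_le_rpow_or_contract {L c ε δ p β R h h' g D γ : ℝ} (hL : 0 < L) (hc : 0 ≤ c)
    (hε : 0 < ε) (hε1 : ε ≤ 1) (hδ : 0 ≤ δ) (hp0 : 0 < p) (hp2 : p ≤ 2)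
    (hpβ : p * (1 - β) = 1)
    (hpεδ : p ≤ 2 * (1 - ε) * (1 + δ)) (hγ : 0 < γ) (hγ1 : γ ≤ 1) (hh : 0 ≤ h)
    (hstep : h' ≤ h - γ * g + γ ^ 2 * (L / 2 * D ^ 2)) (hR : L / 2 * D ^ 2 ≤ R)
    (hhg : (1 + δ) * h ≤ g) (hD : 0 < h → D ^ 2 ≤ c * (g / h) * h ^ β) :
    h' ≤ ((L * c / (2 * ε)) ^ p + R) * γ ^ p ∨ h' ≤ (1 - p / 2 * γ) * h := by
  have hg : 0 ≤ g := hhg.trans' (by positivity)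
  by_cases hcase : h ≤ (L * c / (2 * ε) * γ) ^ p
  · left
    have hR0 : 0 ≤ R := hR.trans' (by positivity)
    have h1 : γ ^ 2 ≤ γ ^ p := by
      rw [← Real.rpow_two]
      exact Real.rpow_le_rpow_of_exponent_ge hγ hγ1 hp2
    calc h' ≤ h - γ * g + γ ^ 2 * (L / 2 * D ^ 2) := hstep
      _ ≤ (L * c / (2 * ε) * γ) ^ p + γ ^ p * R := by
        have h2 : γ ^ 2 * (L / 2 * D ^ 2) ≤ γ ^ p * R := by gcongr
        have h3 : 0 ≤ γ * g := by positivity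
        linarith
      _ = _ := by rw [Real.mul_rpow (by positivity) hγ.le]; ring
  · right
    push Not at hcase
    have hX : 0 ≤ L * c / (2 * ε) * γ := by positivity
    have hh0 : 0 < h := hcase.trans_le' (by positivity)
    have hβ : 0 < 1 - β := by
      by_contra! hn
      nlinarith
    have h1 : L * c / (2 * ε) * γ ≤ h ^ (1 - β) := by
      calc L * c / (2 * ε) * γ = ((L * c / (2 * ε) * γ) ^ p) ^ (1 - β) := by
            rw [← Real.rpow_mul hX, hpβ, Real.rpow_one]
        _ ≤ _ := by gcongr
    have h2 : γ * (L / 2 * D ^ 2) ≤ ε * g := by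
      have e : h ^ (1 - β) = h / h ^ β := by rw [Real.rpow_sub hh0, Real.rpow_one]
      rw [e] at h1
      have hb : 0 < h ^ β := by positivity
      calc γ * (L / 2 * D ^ 2) ≤ γ * (L / 2 * (c * (g / h) * h ^ β)) := by
            have := hD hh0; gcongr
        _ = (L * c / (2 * ε) * γ) * (ε * g * h ^ β / h) := by field_simp
        _ ≤ (h / h ^ β) * (ε * g * h ^ β / h) := by gcongr
        _ = ε * g := by field_simp
    calc h' ≤ h - γ * g + γ * (γ * (L / 2 * D ^ 2)) := by linarith
      _ ≤ h - γ * g + γ * (ε * g) := by gcongr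
      _ = h - γ * (1 - ε) * g := by ring
      _ ≤ h - γ * (1 - ε) * ((1 + δ) * h) := by
        have : 0 ≤ 1 - ε := by linarith
        gcongr
      _ = h - (2 * (1 - ε) * (1 + δ)) * (γ * h / 2) := by ring
      _ ≤ h - p * (γ * h / 2) := by gcongr
      _ = _ := by ring

/-- Points of a compact set whose values tend to the minimum approach the set of minimizers. -/
lemma IsCompact.eventually_infDist_argmin_lt {X : Type*} [PseudoMetricSpace X] {C : Set X}
    (hC : IsCompact C) {f : X → ℝ} (hf : Continuous f) {fstar : ℝ}
    (hfstar : IsLeast (f '' C) fstar) {x : ℕ → X} (hx : ∀ t, x t ∈ C)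
    (hlim : Tendsto (fun t => f (x t) - fstar) atTop (nhds 0)) {ρ : ℝ} (hρ : 0 < ρ) :
    ∀ᶠ t in atTop, Metric.infDist (x t) {y | y ∈ C ∧ f y = fstar} < ρ := by
  set M : Set X := {y | y ∈ C ∧ f y = fstar} with hM
  set S : Set X := C ∩ {y | ρ ≤ Metric.infDist y M} with hS
  have hScomp : IsCompact S :=
    hC.inter_right (isClosed_le continuous_const (Metric.continuous_infDist_pt M))
  rcases S.eq_empty_or_nonempty with hSe | hSne
  · refine Eventually.of_forall fun t => ?_
    by_contra! hlt
    exact (Set.eq_empty_iff_forall_notMem.1 hSe (x t)) ⟨hx t, hlt⟩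
  · obtain ⟨z, hzS, hz⟩ := hScomp.exists_isMinOn hSne hf.continuousOn
    have hzlt : 0 < f z - fstar := by
      rw [sub_pos]
      refine lt_of_le_of_ne (hfstar.2 ⟨z, hzS.1, rfl⟩) fun heq => ?_
      have : Metric.infDist z M = 0 := Metric.infDist_zero_of_mem ⟨hzS.1, heq.symm⟩
      have h2 : ρ ≤ Metric.infDist z M := hzS.2
      linarith
    filter_upwards [hlim.eventually (gt_mem_nhds hzlt)] with t ht
    by_contra! hlt
    have := isMinOn_iff.1 hz (x t) ⟨hx t, hlt⟩
    linarith

/-- **Quantitative rate under LDS plus a local Hölder error bound.**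
Under local dual sharpness around `𝓜` with constants `(A,q)`, `q ≥ 2`, and a local
Hölder error bound of order `r ≥ 2` with constants `(B,ρ)`, Frank–Wolfe with the
short-step rule, exact line search, or the classical open-loop rule satisfies
`f(x_t) - f* ≤ K/(t - t₀ + 1)^{rq/(rq-2)}` for all `t ≥ t₀`. -/
theorem lds_heb_quantitative_rate
    {d : ℕ} {C : Set (EuclideanSpace ℝ (Fin d))}
    (hCne : C.Nonempty) (hCcomp : IsCompact C) (hCconv : Convex ℝ C)
    {f : EuclideanSpace ℝ (Fin d) → ℝ}
    {f' : EuclideanSpace ℝ (Fin d) → EuclideanSpace ℝ (Fin d)}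
    (hfconv : ConvexOn ℝ Set.univ f)
    (hgrad : ∀ y, HasGradientAt f (f' y) y)
    {L : ℝ} (hL : 0 < L)
    (hsmooth : ∀ x ∈ C, ∀ y ∈ C,
      f y ≤ f x + ⟪f' x, y - x⟫ + L / 2 * ‖y - x‖ ^ 2)
    {fstar : ℝ} (hfstar : IsLeast (f '' C) fstar)
    {lmo : EuclideanSpace ℝ (Fin d) → EuclideanSpace ℝ (Fin d)}
    (hlmo : ∀ g, lmo g ∈ C ∧ ∀ y ∈ C, ⟪g, lmo g⟫ ≤ ⟪g, y⟫)
    {A q : ℝ} (hA : 0 < A) (hq : 2 ≤ q)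
    (hLDS : ∃ ρ > (0 : ℝ), ∀ x ∈ C,
      Metric.infDist x {y | y ∈ C ∧ f y = fstar} < ρ →
      ∀ g : EuclideanSpace ℝ (Fin d),
        A * ‖g‖ * ‖x - lmo g‖ ^ q ≤ ⟪g, x - lmo g⟫)
    {r B ρheb : ℝ} (hr : 2 ≤ r) (hB : 0 < B) (hρheb : 0 < ρheb)
    (hHEB : ∀ y ∈ C, Metric.infDist y {z | z ∈ C ∧ f z = fstar} < ρheb →
      Metric.infDist y {z | z ∈ C ∧ f z = fstar} ^ r ≤ B * (f y - fstar))
    {x s : ℕ → EuclideanSpace ℝ (Fin d)} {γ : ℕ → ℝ}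
    (hx0 : x 0 ∈ C)
    (hs : ∀ t, s t = lmo (f' (x t)))
    (hupd : ∀ t, x (t + 1) = x t + γ t • (s t - x t))
    (hrule :
      (∀ t, γ t =
          min (⟪f' (x t), x t - s t⟫ / (L * ‖x t - s t‖ ^ 2)) 1)
      ∨ (∀ t, γ t ∈ Set.Icc (0 : ℝ) 1 ∧
          ∀ γ' ∈ Set.Icc (0 : ℝ) 1,
            f (x t + γ t • (s t - x t)) ≤ f (x t + γ' • (s t - x t)))
      ∨ (∀ t, γ t = 2 / ((t : ℝ) + 2))) :
    ∃ t0 : ℕ, ∃ K > (0 : ℝ), ∀ t : ℕ, t0 ≤ t →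
      f (x t) - fstar ≤ K / ((t - t0 + 1 : ℕ) : ℝ) ^ (r * q / (r * q - 2)) := by
  obtain ⟨ρlds, hρlds, hLDS⟩ := hLDS
  set M : Set (EuclideanSpace ℝ (Fin d)) := {y | y ∈ C ∧ f y = fstar} with hM
  have hfcont : Continuous f :=
    continuous_iff_continuousAt.2 fun y => (hgrad y).hasFDerivAt.continuousAt
  have hMne : M.Nonempty := by
    obtain ⟨y, hy, hfy⟩ := hfstar.1
    exact ⟨y, hy, hfy⟩
  have hMcomp : IsCompact M := hCcomp.inter_right (isClosed_eq hfcont continuous_const)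
  have hsC : ∀ t, s t ∈ C := fun t => hs t ▸ (hlmo _).1
  have hg_le : ∀ t, ∀ y ∈ C, ⟪f' (x t), x t - y⟫ ≤ ⟪f' (x t), x t - s t⟫ := by
    intro t y hy
    have := (hlmo (f' (x t))).2 y hy
    rw [← hs t] at this
    simp only [inner_sub_right]
    linarith
  have hγ01 : ∀ t, x t ∈ C → γ t ∈ Set.Icc (0 : ℝ) 1 := by
    intro t hxt
    rcases hrule with h | h | h
    · rw [h t]
      have : 0 ≤ ⟪f' (x t), x t - s t⟫ := by simpa using hg_le t (x t) hxt
      exact ⟨by positivity, min_le_right _ _⟩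
    · exact (h t).1
    · rw [h t]
      refine ⟨by positivity, ?_⟩
      have : (0 : ℝ) ≤ t := t.cast_nonneg
      rw [div_le_one (by positivity)]
      linarith
  have hxC : ∀ t, x t ∈ C := by
    intro t
    induction t with
    | zero => exact hx0
    | succ t ih =>
      rw [hupd t]
      exact hCconv.add_smul_sub_mem ih (hsC t) (hγ01 t ih)
  set h : ℕ → ℝ := fun t => f (x t) - fstar with hh
  set g : ℕ → ℝ := fun t => ⟪f' (x t), x t - s t⟫ with hg
  have h_nonneg : ∀ t, 0 ≤ h t := fun t => sub_nonneg.2 (hfstar.2 ⟨x t, hxC t, rfl⟩)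
  have hconv : ∀ t, ∀ y, f (x t) - f y ≤ ⟪f' (x t), x t - y⟫ := by
    intro t y
    have := hfconv.add_inner_gradient_le_s12 (hgrad (x t)) y
    rw [← neg_sub (x t) y, inner_neg_right] at this
    linarith
  have hhg : ∀ t, h t ≤ g t := by
    intro t
    obtain ⟨y, hyC, hy⟩ := hMne
    have := (hconv t y).trans (hg_le t y hyC)
    rwa [hy] at this
  have hmodel : ∀ t, ∀ τ ∈ Set.Icc (0 : ℝ) 1, f (x t + τ • (s t - x t)) ≤
      f (x t) - τ * g t + τ ^ 2 * (L / 2 * ‖x t - s t‖ ^ 2) := by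
    intro t τ hτ
    have := hsmooth (x t) (hxC t) _ (hCconv.add_smul_sub_mem (hxC t) (hsC t) hτ)
    rw [add_sub_cancel_left, inner_smul_right, norm_smul, Real.norm_of_nonneg hτ.1, mul_pow,
      ← neg_sub (x t) (s t), inner_neg_right, norm_neg] at this
    rw [← neg_sub (x t) (s t)]
    linarith
  set η : ℕ → ℝ := fun t => 2 / ((t : ℝ) + 2) with hη
  have hη0 : ∀ t, 0 < η t := fun t => by positivity
  have hη1 : ∀ t, η t ≤ 1 := by
    intro t
    have : (0 : ℝ) ≤ t := t.cast_nonneg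
    rw [hη, div_le_one (by positivity)]
    linarith
  -- Each of the three rules makes at least the progress guaranteed for the open-loop step.
  have hstep : ∀ t, h (t + 1) ≤ h t - η t * g t + η t ^ 2 * (L / 2 * ‖x t - s t‖ ^ 2) := by
    intro t
    have hη01 : η t ∈ Set.Icc (0 : ℝ) 1 := ⟨(hη0 t).le, hη1 t⟩
    suffices f (x (t + 1)) ≤ f (x t) - η t * g t + η t ^ 2 * (L / 2 * ‖x t - s t‖ ^ 2) by
      simp only [hh]; linarith
    rw [hupd t]
    rcases hrule with hr' | hr' | hr'
    · refine (hmodel t _ (hγ01 t (hxC t))).trans ?_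
      rcases eq_or_ne (x t) (s t) with hxs | hxs
      · simp [hg, hxs]
      · have ha : 0 < L * ‖x t - s t‖ ^ 2 := by
          have := norm_pos_iff.2 (sub_ne_zero.2 hxs)
          positivity
        have := shortStep_model_le (g := g t) ha (hη1 t)
        rw [hr' t]
        linarith
    · exact ((hr' t).2 _ hη01).trans (hmodel t _ hη01)
    · rw [hr' t]
      exact hmodel t _ hη01
  obtain ⟨D, hD⟩ := Metric.isBounded_iff.1 hCcomp.isBounded
  set R : ℝ := L / 2 * D ^ 2 with hR
  have hRbd : ∀ t, L / 2 * ‖x t - s t‖ ^ 2 ≤ R := by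
    intro t
    have := hD (hxC t) (hsC t)
    rw [dist_eq_norm] at this
    rw [hR]
    gcongr
  have hlim : Tendsto h atTop (nhds 0) := by
    refine tendsto_zero_of_openLoop_step h_nonneg (R := R) fun t => (hstep t).trans ?_
    have h1 := mul_le_mul_of_nonneg_left (hhg t) (hη0 t).le
    have h2 := mul_le_mul_of_nonneg_left (hRbd t) (sq_nonneg (η t))
    change _ ≤ (1 - η t) * h t + η t ^ 2 * R
    linarith
  have hnear : ∀ ρ > (0 : ℝ), ∀ᶠ t in atTop, Metric.infDist (x t) M < ρ := fun ρ hρ =>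
    hCcomp.eventually_infDist_argmin_lt hfcont hfstar hxC hlim hρ
  have hproj : ∀ t, ∃ y ∈ M, Metric.infDist (x t) M = ‖x t - y‖ := by
    intro t
    obtain ⟨y, hyM, hy⟩ := hMcomp.exists_infDist_eq_dist hMne (x t)
    exact ⟨y, hyM, by rw [hy, dist_eq_norm]⟩
  have hsharp : ∀ᶠ t in atTop, A * ‖f' (x t)‖ * ‖x t - s t‖ ^ q ≤ g t := by
    filter_upwards [hnear ρlds hρlds] with t ht
    have := hLDS (x t) (hxC t) ht (f' (x t))
    rwa [← hs t] at this
  have hgradbd : ∀ᶠ t in atTop, h t ≤ ‖f' (x t)‖ * (B * h t) ^ (1 / r) := by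
    filter_upwards [hnear ρheb hρheb] with t ht
    have h1 := hHEB (x t) (hxC t) ht
    obtain ⟨y, hyM, hy⟩ := hproj t
    rw [hy] at h1
    have h2 : ‖x t - y‖ ≤ (B * h t) ^ (1 / r) := by
      rw [one_div, Real.le_rpow_inv_iff_of_pos (norm_nonneg _)
        (mul_nonneg hB.le (h_nonneg t)) (by linarith)]
      exact h1
    have h3 := hconv t y
    rw [hyM.2] at h3
    calc h t ≤ ⟪f' (x t), x t - y⟫ := h3
      _ ≤ ‖f' (x t)‖ * ‖x t - y‖ := real_inner_le_norm _ _
      _ ≤ _ := by gcongr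
  set p : ℝ := r * q / (r * q - 2) with hp
  have hrq : 4 ≤ r * q := by nlinarith
  have hrq2 : 0 < r * q - 2 := by linarith
  have hp1 : 1 ≤ p := by rw [hp, le_div_iff₀ hrq2]; linarith
  have hp2 : p ≤ 2 := by rw [hp, div_le_iff₀ hrq2]; linarith
  -- If the Frank–Wolfe gap has some slack, the dichotomy for a single step applies.
  have of_slack : ∀ ε δ : ℝ, 0 < ε → ε ≤ 1 → 0 ≤ δ → p ≤ 2 * (1 - ε) * (1 + δ) →
      (∀ᶠ t in atTop, (1 + δ) * h t ≤ g t) →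
      ∃ t0 : ℕ, ∃ K > (0 : ℝ), ∀ t : ℕ, t0 ≤ t → h t ≤ K / ((t - t0 + 1 : ℕ) : ℝ) ^ p := by
    intro ε δ hε hε1 hδ hpεδ hslack
    set c : ℝ := (B ^ (1 / r) / A) ^ (2 / q) with hc
    have hc0 : 0 ≤ c := by positivity
    have hR0 : 0 ≤ R := by positivity
    obtain ⟨T, hT⟩ := eventually_atTop.1 (hslack.and (hsharp.and hgradbd))
    refine exists_le_div_rpow_of_step h_nonneg hp1 le_rfl
      (E := (L * c / (2 * ε)) ^ p + R) (by positivity) (T := T) fun t ht => ?_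
    obtain ⟨h1, h2, h3⟩ := hT t ht
    have e : 1 - p / ((t : ℝ) + 2) + 0 / ((t : ℝ) + 2) ^ 2 = 1 - p / 2 * η t := by
      simp only [hη]; ring
    rw [e]
    refine step_le_rpow_or_contract hL hc0 hε hε1 hδ (by linarith) hp2 (β := 2 / (r * q)) ?_
      hpεδ (hη0 t) (hη1 t) (h_nonneg t) (hstep t) (hRbd t) h1 fun hpos =>
        sq_le_of_sharpness_of_errorBound hA hB hq hpos (hhg t) (norm_nonneg _) h2 h3
    rw [hp]
    have : r * q ≠ 0 := by linarith
    field_simp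
  rcases hp2.lt_or_eq with hplt | hpeq
  · exact of_slack (1 - p / 2) 0 (by linarith) (by linarith) le_rfl (by linarith)
      (Eventually.of_forall fun t => by simpa using hhg t)
  have hrq4 : r * q = 4 := by
    rw [hp, div_eq_iff hrq2.ne'] at hpeq
    linarith
  have hr2 : r = 2 := by nlinarith
  have hq2 : q = 2 := by nlinarith
  by_cases hz : ∃ z, f z < fstar
  · -- The gradient is bounded away from zero on `C`.
    obtain ⟨z, hz⟩ := hz
    obtain ⟨W, hW⟩ := Metric.isBounded_iff_subset_closedBall z |>.1 hCcomp.isBounded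
    have hgap : 0 < fstar - f z := sub_pos.2 hz
    have hGW : ∀ t, fstar - f z ≤ ‖f' (x t)‖ * W := by
      intro t
      have h1 : ‖x t - z‖ ≤ W := by simpa [dist_eq_norm] using hW (hxC t)
      have h2 := h_nonneg t
      calc fstar - f z ≤ f (x t) - f z := by simp only [hh] at h2; linarith
        _ ≤ ⟪f' (x t), x t - z⟫ := hconv t z
        _ ≤ ‖f' (x t)‖ * ‖x t - z‖ := real_inner_le_norm _ _
        _ ≤ _ := by gcongr
    have hW0 : 0 < W := by
      have h1 := hGW 0
      by_contra! hn
      have := mul_nonpos_of_nonneg_of_nonpos (norm_nonneg (f' (x 0))) hn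
      linarith
    set κ : ℝ := A * (fstar - f z) / W with hκ
    have hκ0 : 0 < κ := by positivity
    set b : ℝ := L / (2 * κ) with hb
    have hb0 : 0 < b := by positivity
    have hηlim : Tendsto η atTop (nhds 0) := tendsto_const_nhds.div_atTop
      (tendsto_atTop_add_const_right _ _ tendsto_natCast_atTop_atTop)
    obtain ⟨T, hT⟩ := eventually_atTop.1
      (hsharp.and (hηlim.eventually (ge_mem_nhds (show 0 < 1 / b by positivity))))
    refine exists_le_div_rpow_of_step h_nonneg hp1 (c := 4 * b) (by positivity)
      (E := 0) le_rfl (T := T) fun t ht => Or.inr ?_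
    obtain ⟨h1, h2⟩ := hT t ht
    rw [hq2, Real.rpow_two] at h1
    have h3 : κ * ‖x t - s t‖ ^ 2 ≤ g t := by
      refine h1.trans' ?_
      gcongr
      rw [hκ, div_le_iff₀ hW0, mul_assoc]
      have := hGW t
      gcongr
    have h4 : L / 2 * ‖x t - s t‖ ^ 2 ≤ b * g t := by
      calc L / 2 * ‖x t - s t‖ ^ 2 = b * (κ * ‖x t - s t‖ ^ 2) := by
            rw [hb]; field_simp
        _ ≤ b * g t := by gcongr
    have h5 : 0 ≤ 1 - η t * b := by
      rw [le_div_iff₀ hb0] at h2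
      linarith
    have hηt := hη0 t
    have e : 1 - p / ((t : ℝ) + 2) + 4 * b / ((t : ℝ) + 2) ^ 2 = 1 - η t * (1 - η t * b) := by
      simp only [hη, hpeq]; field_simp; ring
    rw [e]
    calc h (t + 1) ≤ h t - η t * g t + η t ^ 2 * (L / 2 * ‖x t - s t‖ ^ 2) := hstep t
      _ ≤ h t - η t * g t + η t ^ 2 * (b * g t) := by gcongr
      _ = h t - η t * (1 - η t * b) * g t := by ring
      _ ≤ h t - η t * (1 - η t * b) * h t := by
        have := hhg t
        gcongr
      _ = _ := by ring
  · push Not at hz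
    obtain ⟨δ, hδ, hslack⟩ :=
      exists_slack_mul_le_inner_gradient hCconv hfconv hgrad hL hB hsmooth
    refine of_slack (δ / (1 + δ)) δ (by positivity) ?_ hδ.le ?_ ?_
    · rw [div_le_one (by positivity)]; linarith
    · have : 2 * (1 - δ / (1 + δ)) * (1 + δ) = 2 := by field_simp; ring
      rw [this]; exact hp2
    · filter_upwards [hnear ρheb hρheb] with t ht
      have h1 := hHEB (x t) (hxC t) ht
      obtain ⟨y, hyM, hy⟩ := hproj t
      rw [hy, hr2, Real.rpow_two] at h1
      have hmin : IsLocalMin f y := Eventually.of_forall fun w => by rw [hyM.2]; exact hz w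
      have hy0 : f' y = 0 := by
        have := hmin.hasFDerivAt_eq_zero (hgrad y).hasFDerivAt
        simpa using this
      have hle : f y ≤ f (x t) := by rw [hyM.2]; exact hz _
      have h2 := hslack (x t) (hxC t) y hyM.1 hy0 hle (by rw [hyM.2]; exact h1)
      rw [hyM.2] at h2
      exact h2.trans (hg_le t y hyM.1)
end
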